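/- Let X ~ Bin(m, p) be a binomial random variable and a = ⌊mp⌋. Then E[X · 1{X ≥ a}] ≥ E[X]/2. -/

import Mathlib

open MeasureTheory Set

/-- The binomial weight `C(m,k) p^k (1-p)^(m-k)`. -/
noncomputable def binomialWeight (m : ℕ) (p : ℝ) (k : ℕ) : ℝ :=
  (m.choose k : ℝ) * p ^ k * (1 - p) ^ (m - k)

namespace binomialWeight

variable {m : ℕ} {p : ℝ}

lemma eq_zero_of_lt {k : ℕ} (hk : m < k) : binomialWeight m p k = 0 := by
  simp [binomialWeight, Nat.choose_eq_zero_of_lt hk]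

lemma nonneg (h0 : 0 ≤ p) (h1 : p ≤ 1) (k : ℕ) : 0 ≤ binomialWeight m p k := by
  have : 0 ≤ 1 - p := by linarith
  unfold binomialWeight
  positivity

lemma pos (h0 : 0 < p) (h1 : p < 1) {k : ℕ} (hk : k ≤ m) : 0 < binomialWeight m p k := by
  have : 0 < 1 - p := by linarith
  have := Nat.choose_pos hk
  unfold binomialWeight
  positivity

lemma succ_mul (k : ℕ) :
    binomialWeight m p (k + 1) * (k + 1) * (1 - p) = binomialWeight m p k * (m - k) * p := by
  rcases lt_trichotomy m k with h | rfl | h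
  · rw [eq_zero_of_lt h, eq_zero_of_lt (by omega)]; ring
  · rw [eq_zero_of_lt (Nat.lt_succ_self m)]; ring
  · have hc : (m.choose (k + 1) : ℝ) * (k + 1) = m.choose k * (m - k) := by
      have := Nat.choose_succ_right_eq m k
      rw [← Nat.cast_sub h.le]
      exact_mod_cast this
    obtain ⟨l, rfl⟩ : ∃ l, m = k + 1 + l := ⟨m - (k + 1), by omega⟩
    have e1 : k + 1 + l - (k + 1) = l := by omega
    have e2 : k + 1 + l - k = l + 1 := by omega
    simp only [binomialWeight, e1, e2, pow_succ]
    linear_combination p ^ k * p * (1 - p) ^ l * (1 - p) * hc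

lemma sum_eq_one (m : ℕ) (p : ℝ) : ∑ k ∈ Finset.range (m + 1), binomialWeight m p k = 1 := by
  have := congrArg (Polynomial.eval p) (bernsteinPolynomial.sum ℝ m)
  simpa [Polynomial.eval_finsetSum, bernsteinPolynomial, binomialWeight] using this

lemma sum_mul_eq (m : ℕ) (p : ℝ) :
    ∑ k ∈ Finset.range (m + 1), (k : ℝ) * binomialWeight m p k = m * p := by
  have := congrArg (Polynomial.eval p) (bernsteinPolynomial.sum_smul ℝ m)
  simpa [Polynomial.eval_finsetSum, bernsteinPolynomial, binomialWeight] using this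

/-- Relates the ratios of the weights placed symmetrically about `j - 1/2`. -/
lemma reflect_mul {j i : ℕ} (hi : i + 1 < j) :
    binomialWeight m p (j + (i + 1)) * binomialWeight m p (j - 1 - i) *
        (((j : ℝ) ^ 2 - (i + 1) ^ 2) * (1 - p) ^ 2) =
      binomialWeight m p (j + i) * binomialWeight m p (j - 1 - (i + 1)) *
        ((((m : ℝ) - j + 1) ^ 2 - (i + 1) ^ 2) * p ^ 2) := by
  obtain ⟨l, rfl⟩ : ∃ l, j = l + i + 2 := ⟨j - i - 2, by omega⟩
  have h1 := succ_mul (m := m) (p := p) (l + i + 2 + i)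
  have h2 := succ_mul (m := m) (p := p) l
  have e1 : l + i + 2 - 1 - i = l + 1 := by omega
  have e2 : l + i + 2 - 1 - (i + 1) = l := by omega
  rw [e1, e2, ← add_assoc]
  push_cast at h1 h2 ⊢
  linear_combination binomialWeight m p (l + 1) * (l + 1) * (1 - p) * h1 +
    binomialWeight m p (l + i + 2 + i) * (m - (l + i + 2 + i)) * p * h2

lemma reflect_step_le (h0 : 0 < p) (h1 : p < 1) {j i : ℕ} (hjm : j ≤ m) (hi : i + 1 < j)
    (hc : ((j : ℝ) ^ 2 - (i + 1) ^ 2) * (1 - p) ^ 2 ≤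
      (((m : ℝ) - j + 1) ^ 2 - (i + 1) ^ 2) * p ^ 2)
    (h : binomialWeight m p (j - 1 - i) ≤ binomialWeight m p (j + i)) :
    binomialWeight m p (j - 1 - (i + 1)) ≤ binomialWeight m p (j + (i + 1)) := by
  have hr := reflect_mul (m := m) (p := p) hi
  have hv : 0 < binomialWeight m p (j - 1 - i) := pos h0 h1 (by omega)
  have hv' : 0 < binomialWeight m p (j - 1 - (i + 1)) := pos h0 h1 (by omega)
  have hij : (i : ℝ) + 1 < j := by exact_mod_cast hi
  have hq : 0 < 1 - p := by linarith
  have hD : 0 < ((j : ℝ) ^ 2 - (i + 1) ^ 2) * (1 - p) ^ 2 :=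
    mul_pos (by nlinarith [(Nat.cast_nonneg i : (0 : ℝ) ≤ i)]) (by positivity)
  refine le_of_mul_le_mul_right ?_ (mul_pos hv hD)
  calc _ = binomialWeight m p (j - 1 - i) * binomialWeight m p (j - 1 - (i + 1)) *
          (((j : ℝ) ^ 2 - (i + 1) ^ 2) * (1 - p) ^ 2) := by ring
    _ ≤ binomialWeight m p (j + i) * binomialWeight m p (j - 1 - (i + 1)) *
          ((((m : ℝ) - j + 1) ^ 2 - (i + 1) ^ 2) * p ^ 2) := by
        have := hv.le.trans h
        gcongr
    _ = _ := by rw [← hr]; ring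

lemma reflect_step_ge (h0 : 0 < p) (h1 : p < 1) {j i : ℕ} (hjm : j ≤ m) (hi : i + 1 < j)
    (hc : (((m : ℝ) - j + 1) ^ 2 - (i + 1) ^ 2) * p ^ 2 ≤
      ((j : ℝ) ^ 2 - (i + 1) ^ 2) * (1 - p) ^ 2)
    (h : binomialWeight m p (j + i) ≤ binomialWeight m p (j - 1 - i)) :
    binomialWeight m p (j + (i + 1)) ≤ binomialWeight m p (j - 1 - (i + 1)) := by
  have hr := reflect_mul (m := m) (p := p) hi
  have hv : 0 < binomialWeight m p (j - 1 - i) := pos h0 h1 (by omega)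
  have hv' : 0 < binomialWeight m p (j - 1 - (i + 1)) := pos h0 h1 (by omega)
  have hu : 0 ≤ binomialWeight m p (j + i) := nonneg h0.le h1.le _
  have hij : (i : ℝ) + 1 < j := by exact_mod_cast hi
  have hq : 0 < 1 - p := by linarith
  have hD : 0 < ((j : ℝ) ^ 2 - (i + 1) ^ 2) * (1 - p) ^ 2 :=
    mul_pos (by nlinarith [(Nat.cast_nonneg i : (0 : ℝ) ≤ i)]) (by positivity)
  refine le_of_mul_le_mul_right ?_ (mul_pos hv hD)
  calc _ = binomialWeight m p (j + i) * binomialWeight m p (j - 1 - (i + 1)) *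
          ((((m : ℝ) - j + 1) ^ 2 - (i + 1) ^ 2) * p ^ 2) := by rw [← hr]; ring
    _ ≤ binomialWeight m p (j + i) * binomialWeight m p (j - 1 - (i + 1)) *
          (((j : ℝ) ^ 2 - (i + 1) ^ 2) * (1 - p) ^ 2) := by gcongr
    _ ≤ binomialWeight m p (j - 1 - i) * binomialWeight m p (j - 1 - (i + 1)) *
          (((j : ℝ) ^ 2 - (i + 1) ^ 2) * (1 - p) ^ 2) := by gcongr
    _ = _ := by ring

lemma reflect_zero_le (h0 : 0 < p) (h1 : p < 1) {j : ℕ} (hj : 0 < j) (hjp : (j : ℝ) ≤ m * p) :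
    binomialWeight m p (j - 1) ≤ binomialWeight m p j := by
  obtain ⟨l, rfl⟩ : ∃ l, j = l + 1 := ⟨j - 1, by omega⟩
  have h := succ_mul (m := m) (p := p) l
  have hv : 0 ≤ binomialWeight m p l := nonneg h0.le h1.le _
  have hq : 0 < 1 - p := by linarith
  rw [Nat.add_sub_cancel]
  push_cast at hjp
  refine le_of_mul_le_mul_right ?_ (mul_pos (by positivity : (0 : ℝ) < l + 1) hq)
  nlinarith

lemma sum_range_two_mul (f : ℕ → ℝ) (j : ℕ) :
    ∑ k ∈ Finset.range (2 * j), f k =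
      ∑ i ∈ Finset.range j, (f (j + i) + f (j - 1 - i)) := by
  rw [two_mul, Finset.sum_range_add, Finset.sum_add_distrib, Finset.sum_range_reflect f j, add_comm]

lemma sum_reflect_le (h0 : 0 < p) (h1 : p < 1) {j : ℕ} (hj : 0 < j) (hjm : j ≤ m)
    (hjp : (j : ℝ) ≤ m * p) :
    ∑ i ∈ Finset.range j, binomialWeight m p (j - 1 - i) ≤
      ∑ i ∈ Finset.range j, binomialWeight m p (j + i) := by
  have hz := reflect_zero_le h0 h1 hj hjp
  have hjm' : (j : ℝ) ≤ m := by exact_mod_cast hjm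
  have hj' : (0 : ℝ) < j := by exact_mod_cast hj
  have hq : 0 < 1 - p := by linarith
  by_cases hall : ∀ i < j, binomialWeight m p (j - 1 - i) ≤ binomialWeight m p (j + i)
  · exact Finset.sum_le_sum fun i hi => hall i (Finset.mem_range.1 hi)
  push Not at hall
  classical
  obtain ⟨htj, hneg⟩ := Nat.find_spec hall
  have hmin : ∀ i < Nat.find hall,
      binomialWeight m p (j - 1 - i) ≤ binomialWeight m p (j + i) := fun i hi => by
    have := Nat.find_min hall hi
    push Not at this
    exact this (hi.trans htj)
  generalize Nat.find hall = t at *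
  obtain ⟨s, rfl⟩ : ∃ s, t = s + 1 := by
    refine Nat.exists_eq_succ_of_ne_zero ?_
    rintro rfl
    exact absurd hz (not_le.2 (by simpa using hneg))
  have hcs : (((m : ℝ) - j + 1) ^ 2 - (s + 1) ^ 2) * p ^ 2 <
      ((j : ℝ) ^ 2 - (s + 1) ^ 2) * (1 - p) ^ 2 := by
    by_contra! hc
    exact absurd (reflect_step_le h0 h1 hjm htj hc (hmin s (Nat.lt_succ_self s))) (not_le.2 hneg)
  have hbase : (j * (1 - p)) ^ 2 ≤ (((m : ℝ) - j + 1) * p) ^ 2 :=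
    pow_le_pow_left₀ (by positivity) (by nlinarith) 2
  have hpq : (1 - p) ^ 2 ≤ p ^ 2 := by
    by_contra! h
    nlinarith [mul_pos (by positivity : (0 : ℝ) < (s + 1) ^ 2) (sub_pos.2 h)]
  have hm2 : m < 2 * j := by
    by_contra! h
    have h' : 2 * (j : ℝ) ≤ m := by exact_mod_cast h
    have hsj : (s : ℝ) + 1 < j := by exact_mod_cast htj
    have hs : (0 : ℝ) ≤ s := Nat.cast_nonneg s
    have hA : (j : ℝ) ^ 2 ≤ ((m : ℝ) - j + 1) ^ 2 := pow_le_pow_left₀ hj'.le (by linarith) 2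
    have hD : (0 : ℝ) ≤ (j : ℝ) ^ 2 - (s + 1) ^ 2 := by nlinarith
    nlinarith [mul_le_mul_of_nonneg_left hpq hD,
      mul_le_mul_of_nonneg_right hA (by positivity : 0 ≤ p ^ 2)]
  have hafter : ∀ i, s + 1 ≤ i → i < j →
      binomialWeight m p (j + i) ≤ binomialWeight m p (j - 1 - i) := by
    intro i hi
    induction i, hi using Nat.le_induction with
    | base => exact fun _ => hneg.le
    | succ n hn ih =>
      intro hnj
      refine reflect_step_ge h0 h1 hjm hnj ?_ (ih (by omega))
      have hsn : ((s : ℝ) + 1) ^ 2 ≤ (n + 1) ^ 2 := by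
        have : (s : ℝ) + 1 ≤ n := by exact_mod_cast hn
        gcongr
        linarith
      nlinarith [mul_le_mul_of_nonneg_left hpq (sub_nonneg.2 hsn)]
  have hsub : Finset.range (m + 1) ⊆ Finset.range (2 * j) := Finset.range_mono (by omega)
  have hone : ∑ i ∈ Finset.range j, (binomialWeight m p (j + i) +
      binomialWeight m p (j - 1 - i)) = 1 := by
    rw [← sum_range_two_mul (binomialWeight m p), ← sum_eq_one m p]
    refine (Finset.sum_subset hsub fun k _ hk => eq_zero_of_lt ?_).symm
    simpa using hk
  have hmean : ∑ i ∈ Finset.range j, (((j + i : ℕ) : ℝ) * binomialWeight m p (j + i) +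
      ((j - 1 - i : ℕ) : ℝ) * binomialWeight m p (j - 1 - i)) = m * p := by
    rw [← sum_range_two_mul (fun k => (k : ℝ) * binomialWeight m p k), ← sum_mul_eq m p]
    refine (Finset.sum_subset hsub fun k _ hk => ?_).symm
    rw [eq_zero_of_lt (by simpa using hk), mul_zero]
  have hweighted : ∑ i ∈ Finset.range j, ((i : ℝ) + 1 / 2) *
      (binomialWeight m p (j + i) - binomialWeight m p (j - 1 - i)) = m * p - (j - 1 / 2) := by
    have hcenter := congrArg (((j : ℝ) - 1 / 2) * ·) hone
    simp only [mul_one] at hcenter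
    rw [← hmean, ← hcenter, Finset.mul_sum, ← Finset.sum_sub_distrib]
    refine Finset.sum_congr rfl fun i hi => ?_
    have hi := Finset.mem_range.1 hi
    rw [Nat.sub_sub, Nat.cast_sub (by omega)]
    push_cast
    ring
  have hle : ∑ i ∈ Finset.range j, ((i : ℝ) + 1 / 2) *
      (binomialWeight m p (j + i) - binomialWeight m p (j - 1 - i)) ≤
      ∑ i ∈ Finset.range j, ((s : ℝ) + 1 + 1 / 2) *
        (binomialWeight m p (j + i) - binomialWeight m p (j - 1 - i)) := by
    refine Finset.sum_le_sum fun i hi => ?_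
    have hi := Finset.mem_range.1 hi
    rcases lt_or_ge i (s + 1) with h | h
    · have h' : (i : ℝ) ≤ s + 1 := by exact_mod_cast h.le
      exact mul_le_mul_of_nonneg_right (by linarith) (sub_nonneg.2 (hmin i h))
    · have h' : (s : ℝ) + 1 ≤ i := by exact_mod_cast h
      exact mul_le_mul_of_nonpos_right (by linarith) (sub_nonpos.2 (hafter i h hi))
  rw [hweighted, ← Finset.mul_sum, Finset.sum_sub_distrib] at hle
  have := pos_of_mul_pos_right (lt_of_lt_of_le (by linarith) hle) (by positivity)
  linarith

/-- A binomial variable is at least as likely to be `≥ j` as to be `< j` when `j` is at most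
its mean. -/
lemma sum_range_le_sum_Ico (h0 : 0 ≤ p) (h1 : p ≤ 1) {j : ℕ} (hjp : (j : ℝ) ≤ m * p) :
    ∑ k ∈ Finset.range j, binomialWeight m p k ≤
      ∑ k ∈ Finset.Ico j (m + 1), binomialWeight m p k := by
  have hR : 0 ≤ ∑ k ∈ Finset.Ico j (m + 1), binomialWeight m p k :=
    Finset.sum_nonneg fun k _ => nonneg h0 h1 k
  rcases Nat.eq_zero_or_pos j with rfl | hj
  · simpa using hR
  have hj' : (0 : ℝ) < j := by exact_mod_cast hj
  have hjm : j ≤ m := by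
    have : (j : ℝ) ≤ m := hjp.trans (mul_le_of_le_one_right (Nat.cast_nonneg m) h1)
    exact_mod_cast this
  have h0' : 0 < p := h0.lt_of_ne (by rintro rfl; linarith)
  rcases h1.eq_or_lt with rfl | h1'
  · refine le_of_eq_of_le (Finset.sum_eq_zero fun k hk => ?_) hR
    have hk := Finset.mem_range.1 hk
    simp [binomialWeight, show m - k ≠ 0 by omega]
  rw [← Finset.sum_range_reflect]
  refine (sum_reflect_le h0' h1' hj hjm hjp).trans ?_
  have : ∑ i ∈ Finset.range j, binomialWeight m p (j + i) =
      ∑ k ∈ Finset.Ico j (2 * j), binomialWeight m p k := by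
    rw [Finset.sum_Ico_eq_sum_range, two_mul, Nat.add_sub_cancel]
  rw [this, ← Finset.sum_filter_add_sum_filter_not (Finset.Ico j (2 * j)) (· ≤ m),
    Finset.sum_eq_zero (s := Finset.filter (fun k => ¬ k ≤ m) _), add_zero]
  · refine Finset.sum_le_sum_of_subset_of_nonneg (fun k hk => ?_) fun k _ _ => nonneg h0 h1 k
    simp only [Finset.mem_filter, Finset.mem_Ico] at hk ⊢
    omega
  · intro k hk
    exact eq_zero_of_lt (by simpa using (Finset.mem_filter.1 hk).2)

end binomialWeight

/-- The expectation of a function of a binomial variable. -/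
lemma integral_comp_eq_sum_binomialWeight {Ω : Type*} [MeasurableSpace Ω] (μ : Measure Ω)
    [IsProbabilityMeasure μ] {m : ℕ} {p : ℝ} {X : Ω → ℕ} (hX : Measurable X)
    (hbin : ∀ k : ℕ, (μ {ω | X ω = k}).toReal = binomialWeight m p k) (g : ℕ → ℝ) :
    ∫ ω, g (X ω) ∂μ = ∑ k ∈ Finset.range (m + 1), g k * binomialWeight m p k := by
  have hmeas : ∀ k, MeasurableSet {ω | X ω = k} := fun k => hX (measurableSet_singleton k)
  have hle : ∀ᵐ ω ∂μ, X ω ≤ m := by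
    have : ∀ᵐ ω ∂μ, ∀ k, m < k → X ω ≠ k := by
      refine ae_all_iff.2 fun k => ?_
      by_cases hk : m < k
      · have h := hbin k
        rw [binomialWeight.eq_zero_of_lt hk, ENNReal.toReal_eq_zero_iff] at h
        have h := h.resolve_right (measure_ne_top μ _)
        simpa [ae_iff, hk] using h
      · exact Filter.Eventually.of_forall fun ω h => absurd h hk
    filter_upwards [this] with ω h
    by_contra! hlt
    exact h _ hlt rfl
  have hae : (fun ω => g (X ω)) =ᵐ[μ] fun ω => ∑ k ∈ Finset.range (m + 1),
      Set.indicator {ω | X ω = k} (fun _ => g k) ω := by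
    filter_upwards [hle] with ω h
    simp [Set.indicator_apply, Nat.lt_succ_of_le h]
  rw [integral_congr_ae hae, integral_finsetSum _ fun k _ =>
    (integrable_const (g k)).indicator (hmeas k)]
  refine Finset.sum_congr rfl fun k _ => ?_
  rw [integral_indicator_const _ (hmeas k), measureReal_def, hbin k, smul_eq_mul, mul_comm]



/-- For `X ~ Bin(m,p)` and `a = ⌊mp⌋`, `E[X·1{X ≥ a}] ≥ E[X]/2`. -/
theorem stmt12 {Ω : Type*} [MeasurableSpace Ω] (μ : Measure Ω) [IsProbabilityMeasure μ]
    (m : ℕ) (p : ℝ) (hp : p ∈ Set.Icc (0 : ℝ) 1)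
    (X : Ω → ℕ) (hX : Measurable X)
    (hbin : ∀ k : ℕ, (μ {ω | X ω = k}).toReal
      = (m.choose k : ℝ) * p ^ k * (1 - p) ^ (m - k)) :
    (∫ ω, (X ω : ℝ) ∂μ) / 2 ≤
      ∫ ω, (if ⌊(m : ℝ) * p⌋₊ ≤ X ω then (X ω : ℝ) else 0) ∂μ := by
  rw [integral_comp_eq_sum_binomialWeight μ hX hbin (fun k => (k : ℝ)),
    integral_comp_eq_sum_binomialWeight μ hX hbin
      (fun k => if ⌊(m : ℝ) * p⌋₊ ≤ k then (k : ℝ) else 0)]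
  have hjp : (⌊(m : ℝ) * p⌋₊ : ℝ) ≤ m * p :=
    Nat.floor_le (mul_nonneg (Nat.cast_nonneg m) hp.1)
  have hjm : ⌊(m : ℝ) * p⌋₊ ≤ m + 1 := by
    have : (⌊(m : ℝ) * p⌋₊ : ℝ) ≤ m :=
      hjp.trans (mul_le_of_le_one_right (Nat.cast_nonneg m) hp.2)
    exact Nat.le_succ_of_le (by exact_mod_cast this)
  generalize ⌊(m : ℝ) * p⌋₊ = j at *
  have hmedian := binomialWeight.sum_range_le_sum_Ico hp.1 hp.2 hjp
  have hlow : ∑ k ∈ Finset.range j, (k : ℝ) * binomialWeight m p k ≤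
      j * ∑ k ∈ Finset.range j, binomialWeight m p k := by
    rw [Finset.mul_sum]
    refine Finset.sum_le_sum fun k hk => mul_le_mul_of_nonneg_right ?_
      (binomialWeight.nonneg hp.1 hp.2 k)
    exact_mod_cast (Finset.mem_range.1 hk).le
  have hhigh : j * ∑ k ∈ Finset.Ico j (m + 1), binomialWeight m p k ≤
      ∑ k ∈ Finset.Ico j (m + 1), (k : ℝ) * binomialWeight m p k := by
    rw [Finset.mul_sum]
    refine Finset.sum_le_sum fun k hk => mul_le_mul_of_nonneg_right ?_
      (binomialWeight.nonneg hp.1 hp.2 k)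
    exact_mod_cast (Finset.mem_Ico.1 hk).1
  have hmid := mul_le_mul_of_nonneg_left hmedian (Nat.cast_nonneg (α := ℝ) j)
  rw [← Finset.sum_range_add_sum_Ico _ hjm, ← Finset.sum_range_add_sum_Ico _ hjm,
    Finset.sum_eq_zero (s := Finset.range j) (f := fun k => (if j ≤ k then (k : ℝ) else 0) * _)
      fun k hk => by rw [if_neg (not_le.2 (Finset.mem_range.1 hk)), zero_mul],
    Finset.sum_congr (s₁ := Finset.Ico j (m + 1)) rfl (f := fun k => (if j ≤ k then _ else _) * _)
      fun k hk => by rw [if_pos (Finset.mem_Ico.1 hk).1]]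
  linarith
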